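/- arXiv:2111.04660 — 2 statements merged into one kernel-verified Lean document; each statement's English description precedes it below -/
import Mathlib

section
/- Let α and β be algebraic numbers in a fixed algebraic closure of ℚ with minimal polynomials f and g over ℚ respectively, and assume that ℚ(α) and ℚ(β) are linearly disjoint over ℚ. Then the minimal polynomial of α + β over ℚ is exactly R_{f,g}(y) = Res_x(f(x), g(y − x)). -/
open Polynomial

/-- The Sylvester matrix of two polynomials `f` and `g`, regarded as having degrees
`n` and `m` respectively: the first `m` rows contain the coefficients of `f`
(in descending order, shifted), the last `n` rows those of `g`. -/
noncomputable def sylvester {R : Type*} [CommRing R] (n m : ℕ) (f g : R[X]) :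
    Matrix (Fin (m + n)) (Fin (m + n)) R :=
  Matrix.of fun i j =>
    if (i : ℕ) < m then
      (if (j : ℕ) ≤ n + (i : ℕ) then f.coeff (n + (i : ℕ) - (j : ℕ)) else 0)
    else
      (if (j : ℕ) ≤ m + ((i : ℕ) - m) then g.coeff (m + ((i : ℕ) - m) - (j : ℕ)) else 0)

/-- The resultant of two polynomials `f` and `g`, regarded as having degrees
`n` and `m` respectively: the determinant of their Sylvester matrix. -/
noncomputable def resultant {R : Type*} [CommRing R] (n m : ℕ) (f g : R[X]) : R :=
  (sylvester n m f g).det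

/-- `Rres f g` is the polynomial `R_{f,g}(y) = Res_x(f(x), g(y - x))`, the resultant with
respect to the variable `x` of `f(x)` and `g(y - x)`, viewed as a polynomial in `y`. -/
noncomputable def Rres {R : Type*} [CommRing R] (f g : R[X]) : R[X] :=
  resultant f.natDegree g.natDegree (f.map (C : R →+* R[X]))
    ((g.map (C : R →+* R[X])).comp (C X - X))


open IntermediateField

/-- For size parameters bounding the degrees, `resultant` agrees with Mathlib's resultant. -/
lemma resultant_eq_polynomial_resultant {R : Type*} [CommRing R] {n m : ℕ} {f g : R[X]}
    (hf : f.natDegree ≤ n) (hg : g.natDegree ≤ m) :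
    _root_.resultant n m f g = Polynomial.resultant f g n m := by
  let e : Fin (m + n) ≃ Fin (n + m) := Fin.revPerm.trans (finCongr (Nat.add_comm m n))
  have he (i : Fin (m + n)) : (e i : ℕ) = m + n - (i + 1) := by simp [e]
  have key : _root_.sylvester n m f g = (Polynomial.sylvester f g n m).transpose.submatrix e e := by
    ext i j
    have hi := he i
    have hj := he j
    rw [Matrix.submatrix_apply, Matrix.transpose_apply]
    generalize e i = i' at *
    generalize e j = j' at *
    induction i' using Fin.addCases with
    | left k =>
      simp only [_root_.sylvester, Polynomial.sylvester, Matrix.of_apply, Fin.addCases_left,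
        Set.mem_Icc, Fin.val_castAdd] at hi ⊢
      rw [if_neg (by omega)]
      split_ifs with h₁ h₂ h₂
      · congr 1; omega
      · exact coeff_eq_zero_of_natDegree_lt (by omega)
      · omega
      · rfl
    | right k =>
      simp only [_root_.sylvester, Polynomial.sylvester, Matrix.of_apply, Fin.addCases_right,
        Set.mem_Icc, Fin.val_natAdd] at hi ⊢
      rw [if_pos (by omega)]
      split_ifs with h₁ h₂ h₂
      · congr 1; omega
      · exact coeff_eq_zero_of_natDegree_lt (by omega)
      · omega
      · rfl
  rw [_root_.resultant, key, Matrix.det_submatrix_equiv_self, Matrix.det_transpose,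
    Polynomial.resultant]

lemma natDegree_map_C_comp_C_X_sub_X_le {R : Type*} [CommRing R] (p : R[X]) :
    ((p.map (C : R →+* R[X])).comp (C X - X)).natDegree ≤ p.natDegree := by
  have h : (C X - X : R[X][X]).natDegree ≤ 1 :=
    (natDegree_sub_le _ _).trans (by simpa using natDegree_X_le)
  calc _ ≤ (p.map C).natDegree * (C X - X : R[X][X]).natDegree := natDegree_comp_le
    _ ≤ p.natDegree * 1 := Nat.mul_le_mul natDegree_map_le h
    _ = p.natDegree := mul_one _

/-- If `f` is monic and splits over `K`, then over `K` the polynomial `Rres f g` is the product of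
the `g (y - a)` over the roots `a` of `f`. -/
lemma map_Rres {F K : Type*} [Field F] [Field K] (φ : F →+* K) {f g : F[X]} (hf : f.Monic)
    (hs : (f.map φ).Splits) :
    (Rres f g).map φ = ((f.map φ).roots.map fun a => (g.map φ).comp (X - C a)).prod := by
  have hmap (p : F[X]) : (p.map C).map (mapRingHom φ) = (p.map φ).map C := by
    rw [Polynomial.map_map, Polynomial.map_map, mapRingHom_comp_C]
  have hX : (C X - X : F[X][X]).map (mapRingHom φ) = C X - X := by
    rw [Polynomial.map_sub, map_C, map_X, coe_mapRingHom, map_X]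
  have hmonic : ((f.map φ).map (C : K →+* K[X])).Monic := (hf.map φ).map C
  have hn : ((f.map φ).map (C : K →+* K[X])).natDegree = f.natDegree := by
    rw [(hf.map φ).natDegree_map, hf.natDegree_map]
  have hG : (((g.map φ).map (C : K →+* K[X])).comp (C X - X)).natDegree ≤ g.natDegree :=
    (natDegree_map_C_comp_C_X_sub_X_le _).trans natDegree_map_le
  rw [Rres, resultant_eq_polynomial_resultant natDegree_map_le
    (natDegree_map_C_comp_C_X_sub_X_le g), ← coe_mapRingHom,
    ← Polynomial.resultant_map_map, hmap, Polynomial.map_comp, hmap, hX, ← hn,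
    resultant_eq_prod_eval _ _ _ hG (hs.map C), hmonic.leadingCoeff, one_pow, one_mul,
    hs.roots_map, Multiset.map_map]
  congr 1
  refine Multiset.map_congr rfl fun a _ => ?_
  rw [Function.comp_apply, eval_comp, eval_map, Polynomial.comp, eval_sub, eval_C, eval_X,
    coe_mapRingHom]

lemma natDegree_comp_X_sub_C {R : Type*} [CommRing R] [IsDomain R] (p : R[X]) (a : R) :
    (p.comp (X - C a)).natDegree = p.natDegree := by
  simp [natDegree_comp]

lemma monic_Rres {F K : Type*} [Field F] [Field K] (φ : F →+* K) {f g : F[X]} (hf : f.Monic)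
    (hg : g.Monic) (hs : (f.map φ).Splits) : (Rres f g).Monic := by
  refine monic_of_injective φ.injective ?_
  rw [map_Rres φ hf hs]
  exact monic_multiset_prod_of_monic _ _ fun a _ => (hg.map φ).comp_X_sub_C a

lemma natDegree_Rres {F K : Type*} [Field F] [Field K] (φ : F →+* K) {f g : F[X]} (hf : f.Monic)
    (hg : g.Monic) (hs : (f.map φ).Splits) : (Rres f g).natDegree = f.natDegree * g.natDegree := by
  rw [← natDegree_map φ, map_Rres φ hf hs, natDegree_multiset_prod_of_monic]
  · simp [Multiset.map_map, natDegree_comp_X_sub_C, ← hs.natDegree_eq_card_roots]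
  · intro p hp
    obtain ⟨a, -, rfl⟩ := Multiset.mem_map.1 hp
    exact (hg.map φ).comp_X_sub_C a

section LinearDisjoint

variable {F K : Type*} [Field F] [Field K] [Algebra F K]

lemma aeval_add_Rres {f g : F[X]} (hf : f.Monic) (hs : (f.map (algebraMap F K)).Splits)
    {α β : K} (hα : aeval α f = 0) (hβ : aeval β g = 0) : aeval (α + β) (Rres f g) = 0 := by
  rw [aeval_def, ← eval_map, map_Rres _ hf hs, eval_multiset_prod, Multiset.map_map]
  refine Multiset.prod_eq_zero (Multiset.mem_map.2 ⟨α, ?_, ?_⟩)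
  · exact (mem_roots (hf.map _).ne_zero).2 (by rwa [IsRoot, eval_map_algebraMap])
  · simpa [eval_comp, eval_map_algebraMap] using hβ

/-- If `F(α)` and `F(β)` are linearly disjoint, then `β` has the same minimal polynomial over
`F(α)` as over `F`. -/
lemma minpoly_eq_map_of_linearDisjoint {α β : K} (hβ : IsIntegral F β)
    (h : F⟮α⟯.LinearDisjoint F⟮β⟯) :
    minpoly F⟮α⟯ β = (minpoly F β).map (algebraMap F F⟮α⟯) := by
  refine (eq_of_dvd_of_natDegree_le_of_leadingCoeff
    (minpoly.dvd_map_of_isScalarTower F F⟮α⟯ β) ?_ ?_)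
  · rw [natDegree_map]
    by_contra! hlt
    have hli := h.linearIndependent_right (linearIndependent_pow (K := F) (AdjoinSimple.gen F β))
    have hm : minpoly F (AdjoinSimple.gen F β) = minpoly F β := minpoly_gen F β
    rw [hm] at hli
    have hβ' : IsIntegral F⟮α⟯ β := hβ.tower_top
    have hsum := minpoly.aeval F⟮α⟯ β
    rw [aeval_eq_sum_range' hlt, ← Fin.sum_univ_eq_sum_range
      (fun i => (minpoly F⟮α⟯ β).coeff i • β ^ i)] at hsum
    have hz := Fintype.linearIndependent_iff.1 hli
      (fun i => (minpoly F⟮α⟯ β).coeff i) (by simpa using hsum) ⟨_, hlt⟩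
    exact (minpoly.monic hβ').leadingCoeff.symm ▸ one_ne_zero <| hz
  · rw [(minpoly.monic hβ.tower_top).leadingCoeff, ((minpoly.monic hβ).map _).leadingCoeff]

/-- If `F(α)` and `F(β)` are linearly disjoint, then the automorphism group of a normal extension
acts transitively on pairs of a conjugate of `α` and a conjugate of `β`. -/
lemma exists_algEquiv_of_linearDisjoint [Normal F K] {α β a b : K}
    (h : F⟮α⟯.LinearDisjoint F⟮β⟯) (ha : aeval a (minpoly F α) = 0)
    (hb : aeval b (minpoly F β) = 0) : ∃ τ : K ≃ₐ[F] K, τ α = a ∧ τ β = b := by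
  have hint (x : K) : IsIntegral F x := Normal.isIntegral ‹_› x
  obtain ⟨τ, hτ⟩ := minpoly.exists_algEquiv_of_root' (hint α).isAlgebraic ha
  have : Normal F⟮α⟯ K := Normal.tower_top_of_normal F F⟮α⟯ K
  have hb' : aeval (τ.symm b) (minpoly F⟮α⟯ β) = 0 := by
    rw [minpoly_eq_map_of_linearDisjoint (hint β) h, aeval_map_algebraMap, aeval_algHom_apply τ.symm,
      hb, map_zero]
  obtain ⟨ρ, hρ⟩ := minpoly.exists_algEquiv_of_root' (hint β).tower_top.isAlgebraic hb'
  refine ⟨(ρ.restrictScalars F).trans τ, ?_, ?_⟩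
  · have : ρ α = α := ρ.commutes (AdjoinSimple.gen F α)
    simp [this, hτ]
  · simp [hρ]

/-- In characteristic zero, an automorphism fixing `α + β` fixes both `α` and `β`, provided that
`F(α)` and `F(β)` are linearly disjoint. -/
lemma apply_eq_of_apply_add_eq [CharZero K] [Normal F K] {α β : K}
    (h : F⟮α⟯.LinearDisjoint F⟮β⟯) (σ : K ≃ₐ[F] K) (hσ : σ (α + β) = α + β) :
    σ α = α ∧ σ β = β := by
  classical
  have hint (x : K) : IsIntegral F x := Normal.isIntegral ‹_› x
  have hmem (x y : K) : y ∈ ((minpoly F x).aroots K).toFinset ↔ aeval y (minpoly F x) = 0 := by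
    simp [minpoly.ne_zero (hint x)]
  have hconj (ρ : K ≃ₐ[F] K) (x : K) : aeval (ρ x) (minpoly F x) = 0 := by
    rw [aeval_algHom_apply ρ, minpoly.aeval, map_zero]
  have : Algebra ℚ K := DivisionRing.toRatAlgebra
  obtain ⟨a, ha, b, hb, hu⟩ := UniqueSums.uniqueAdd_of_nonempty (G := K)
    (A := ((minpoly F α).aroots K).toFinset) (B := ((minpoly F β).aroots K).toFinset)
    ⟨α, (hmem _ _).2 (minpoly.aeval F α)⟩ ⟨β, (hmem _ _).2 (minpoly.aeval F β)⟩
  obtain ⟨τ, rfl, rfl⟩ :=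
    exists_algEquiv_of_linearDisjoint h ((hmem _ _).1 ha) ((hmem _ _).1 hb)
  have := hu ((hmem _ _).2 (hconj (σ.trans τ) α)) ((hmem _ _).2 (hconj (σ.trans τ) β))
    (by simpa using congrArg τ hσ)
  simpa using this

/-- In characteristic zero, `α + β` is a primitive element of `F(α, β)`, provided that `F(α)` and
`F(β)` are linearly disjoint. -/
lemma adjoin_add_eq_sup_of_linearDisjoint [CharZero K] [IsGalois F K] {α β : K}
    (h : F⟮α⟯.LinearDisjoint F⟮β⟯) : F⟮α + β⟯ = F⟮α⟯ ⊔ F⟮β⟯ := by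
  refine le_antisymm ?_ (sup_le ?_ ?_)
  · refine adjoin_simple_le_iff.2 (add_mem ?_ ?_)
    · exact (le_sup_left : F⟮α⟯ ≤ F⟮α⟯ ⊔ F⟮β⟯) (mem_adjoin_simple_self F α)
    · exact (le_sup_right : F⟮β⟯ ≤ F⟮α⟯ ⊔ F⟮β⟯) (mem_adjoin_simple_self F β)
  all_goals
    rw [adjoin_simple_le_iff, ← InfiniteGalois.fixedField_fixingSubgroup F⟮α + β⟯, mem_fixedField_iff]
    intro σ hσ
    have := apply_eq_of_apply_add_eq h σ
      ((mem_fixingSubgroup_iff _ _).1 hσ _ (mem_adjoin_simple_self F (α + β)))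
  · exact this.1
  · exact this.2

lemma natDegree_minpoly_add_of_linearDisjoint [CharZero K] [IsGalois F K] {α β : K}
    (h : F⟮α⟯.LinearDisjoint F⟮β⟯) :
    (minpoly F (α + β)).natDegree = (minpoly F α).natDegree * (minpoly F β).natDegree := by
  have hint (x : K) : IsIntegral F x := IsGalois.integral F x
  rw [← adjoin.finrank (hint _), ← adjoin.finrank (hint _), ← adjoin.finrank (hint _),
    adjoin_add_eq_sup_of_linearDisjoint h, h.finrank_sup]

end LinearDisjoint

/-- if `α`, `β` are algebraic numbers in a fixed algebraic closure of `ℚ` with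
minimal polynomials `f`, `g` over `ℚ`, and `ℚ(α)`, `ℚ(β)` are linearly disjoint over `ℚ`,
then the minimal polynomial of `α + β` over `ℚ` is exactly `R_{f,g}(y) = Res_x(f(x), g(y-x))`. -/
theorem stmt5 (α β : AlgebraicClosure ℚ)
    (hdisj : (adjoin ℚ ({α} : Set (AlgebraicClosure ℚ))).LinearDisjoint
      (adjoin ℚ ({β} : Set (AlgebraicClosure ℚ))))
    (f g : ℚ[X]) (hf : f = minpoly ℚ α) (hg : g = minpoly ℚ β) :
    minpoly ℚ (α + β) = Rres f g := by
  subst hf hg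
  have hclosure : IsAlgClosure ℚ (AlgebraicClosure ℚ) := by
    convert (inferInstance :
      @IsAlgClosure ℚ (AlgebraicClosure ℚ) _ _ (AlgebraicClosure.instAlgebra ℚ) _)
    exact Subsingleton.elim _ _
  have : IsGalois ℚ (AlgebraicClosure ℚ) := IsAlgClosure.isGalois ℚ _
  have hint (x : AlgebraicClosure ℚ) : IsIntegral ℚ x := IsGalois.integral ℚ x
  have hα := minpoly.monic (hint α)
  have hβ := minpoly.monic (hint β)
  have hs : ((minpoly ℚ α).map (algebraMap ℚ (AlgebraicClosure ℚ))).Splits :=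
    IsAlgClosed.splits _
  refine eq_of_dvd_of_natDegree_le_of_leadingCoeff
    (minpoly.dvd _ _ (aeval_add_Rres hα hs (minpoly.aeval _ _) (minpoly.aeval _ _))) ?_ ?_
  · rw [natDegree_Rres _ hα hβ hs, natDegree_minpoly_add_of_linearDisjoint hdisj]
  · rw [(minpoly.monic (hint _)).leadingCoeff, (monic_Rres _ hα hβ hs).leadingCoeff]
end

section
/- Let f, g ∈ ℤ[x] be monic irreducible polynomials of coprime degrees such that ℚ[x]/(f) and ℚ[x]/(g) are normal (Galois) extensions of ℚ. Then for every prime p and every root t ∈ 𝔽_p of the reduction of R_{f,g} modulo p, there exist r, s ∈ 𝔽_p such that f(r) ≡ 0 (mod p), g(s) ≡ 0 (mod p), and t = r + s. -/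
open Polynomial

open IntermediateField

section Reflection

variable {K : Type*} [Field K]

lemma comp_C_sub_X_comp_C_sub_X (t : K) (h : K[X]) : (h.comp (C t - X)).comp (C t - X) = h := by
  simp [comp_assoc]

lemma Irreducible.comp_C_sub_X {h : K[X]} (hh : Irreducible h) (t : K) :
    Irreducible (h.comp (C t - X)) := by
  let e : K[X] ≃+* K[X] := RingEquiv.ofRingHom (compRingHom (C t - X)) (compRingHom (C t - X))
    (RingHom.ext (comp_C_sub_X_comp_C_sub_X t)) (RingHom.ext (comp_C_sub_X_comp_C_sub_X t))
  exact (MulEquiv.irreducible_iff e).2 hh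

lemma natDegree_comp_C_sub_X (t : K) (h : K[X]) : (h.comp (C t - X)).natDegree = h.natDegree := by
  rw [natDegree_comp, natDegree_sub_eq_right_of_natDegree_lt] <;> simp

end Reflection

section Resultant

variable {R S : Type*} [CommRing R] [CommRing S]

/-- Reversal of each of the two blocks of `Fin (m + n)`. -/
def blockRev (m n : ℕ) : Equiv.Perm (Fin (m + n)) :=
  finSumFinEquiv.symm.trans ((Equiv.sumCongr Fin.revPerm Fin.revPerm).trans finSumFinEquiv)

lemma sylvester_submatrix_rev (n m : ℕ) (f g : R[X]) (hf : f.natDegree ≤ n)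
    (hg : g.natDegree ≤ m) :
    (_root_.sylvester n m f g).submatrix (blockRev m n) Fin.revPerm =
      (Polynomial.sylvester g f m n).transpose := by
  ext i j
  have hj := j.isLt
  induction i using Fin.addCases with
  | left i =>
    have hi := i.isLt
    simp only [_root_.sylvester, Polynomial.sylvester, blockRev, Matrix.submatrix_apply,
      Matrix.of_apply, Matrix.transpose_apply, Equiv.trans_apply, finSumFinEquiv_symm_apply_castAdd,
      Equiv.sumCongr_apply, Sum.map_inl, finSumFinEquiv_apply_left, Fin.revPerm_apply,
      Fin.val_castAdd, Fin.val_rev, Fin.addCases_left, Set.mem_Icc]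
    rw [if_pos (by omega)]
    split_ifs with h₁ h₂ h₂
    · congr 1; omega
    · exact coeff_eq_zero_of_natDegree_lt (by omega)
    · omega
    · rfl
  | right i =>
    have hi := i.isLt
    simp only [_root_.sylvester, Polynomial.sylvester, blockRev, Matrix.submatrix_apply,
      Matrix.of_apply, Matrix.transpose_apply, Equiv.trans_apply, finSumFinEquiv_symm_apply_natAdd,
      Equiv.sumCongr_apply, Sum.map_inr, finSumFinEquiv_apply_right, Fin.revPerm_apply,
      Fin.val_natAdd, Fin.val_rev, Fin.addCases_right, Set.mem_Icc]
    rw [if_neg (by omega)]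
    split_ifs with h₁ h₂ h₂
    · congr 1; omega
    · exact coeff_eq_zero_of_natDegree_lt (by omega)
    · omega
    · rfl

lemma resultant_swap_eq_zero {n m : ℕ} {f g : R[X]} (hf : f.natDegree ≤ n) (hg : g.natDegree ≤ m)
    (h : _root_.resultant n m f g = 0) : Polynomial.resultant g f m n = 0 := by
  have key : (_root_.sylvester n m f g).submatrix (blockRev m n) Fin.revPerm =
      ((_root_.sylvester n m f g).submatrix (blockRev m n) id).submatrix id Fin.revPerm := rfl
  rw [Polynomial.resultant, ← Matrix.det_transpose, ← sylvester_submatrix_rev n m f g hf hg, key,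
    Matrix.det_permute', Matrix.det_permute]
  rw [_root_.resultant] at h
  simp [h]

lemma map_resultant (φ : R →+* S) (n m : ℕ) (f g : R[X]) :
    φ (_root_.resultant n m f g) = _root_.resultant n m (f.map φ) (g.map φ) := by
  rw [_root_.resultant, _root_.resultant, RingHom.map_det]
  congr 1
  ext i j
  simp [_root_.sylvester, apply_ite φ]

lemma aeval_Rres [Algebra R S] (f g : R[X]) (t : S) :
    aeval t (Rres f g) = _root_.resultant f.natDegree g.natDegree (f.map (algebraMap R S))
      ((g.map (algebraMap R S)).comp (C t - X)) := by
  rw [Rres, ← AlgHom.coe_toRingHom, map_resultant]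
  have hC : ((aeval t : R[X] →ₐ[R] S) : R[X] →+* S).comp C = algebraMap R S := by
    ext; simp
  rw [Polynomial.map_map, Polynomial.map_comp, Polynomial.map_map, hC]
  simp

/-- If `t` is a root of `R_{f,g}` in a field, then `f(x)` and `g(t - x)` share an irreducible factor
over that field. -/
lemma exists_irreducible_dvd_of_aeval_Rres_eq_zero {K : Type*} [Field K] [Algebra R K]
    {f g : R[X]} (hf : f.Monic) (hg : g.Monic) {t : K} (ht : aeval t (Rres f g) = 0) :
    ∃ h : K[X], Irreducible h ∧ h ∣ f.map (algebraMap R K) ∧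
      h ∣ (g.map (algebraMap R K)).comp (C t - X) := by
  have hfn : (f.map (algebraMap R K)).natDegree = f.natDegree := hf.natDegree_map _
  have hgn : ((g.map (algebraMap R K)).comp (C t - X)).natDegree = g.natDegree := by
    rw [natDegree_comp_C_sub_X, hg.natDegree_map]
  have hnc : ¬ IsCoprime (f.map (algebraMap R K)) ((g.map (algebraMap R K)).comp (C t - X)) := by
    intro hc
    apply Polynomial.resultant_ne_zero _ _ hc.symm
    rw [hfn, hgn]
    exact resultant_swap_eq_zero hfn.le hgn.le (by rw [← aeval_Rres, ht])
  by_contra! H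
  refine hnc (isCoprime_of_irreducible_dvd ?_ fun h hh h₁ h₂ ↦ H h hh h₁ h₂)
  exact fun h0 ↦ (hf.map (algebraMap R K)).ne_zero h0.1

end Resultant

open NumberField

/-- If a monic integer polynomial splits in a Galois number field `K`, the degree of any
irreducible factor of its reduction modulo `p` divides `[K : ℚ]`. -/
lemma natDegree_dvd_finrank_of_dvd_map_zmod {K : Type*} [Field K] [NumberField K] [IsGalois ℚ K]
    {f : ℤ[X]} (hf : f.Monic) (hs : (f.map (algebraMap ℤ K)).Splits) {p : ℕ} [Fact p.Prime]
    {h : (ZMod p)[X]} (hh : Irreducible h) (hdvd : h ∣ f.map (algebraMap ℤ (ZMod p))) :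
    h.natDegree ∣ Module.finrank ℚ K := by
  have hp : p.Prime := Fact.out
  have hpI : Prime (p : ℤ) := Nat.prime_iff_prime_int.mp hp
  let I : Ideal ℤ := Ideal.span {(p : ℤ)}
  have : I.IsPrime := (Ideal.span_singleton_prime hpI.ne_zero).2 hpI
  obtain ⟨⟨P, hP, hPI⟩⟩ := I.nonempty_primesOver (S := 𝓞 K)
  have hI : I ≠ ⊥ := by simpa [I] using hp.ne_zero
  have hPbot : P ≠ ⊥ := Ideal.ne_bot_of_liesOver_of_ne_bot hI P
  have hPmax : P.IsMaximal := hP.isMaximal hPbot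
  let := Ideal.Quotient.field P
  have hchar : CharP (𝓞 K ⧸ P) p := by
    refine (CharP.charP_iff_prime_eq_zero hp).2 ?_
    rw [← map_natCast (Ideal.Quotient.mk P), Ideal.Quotient.eq_zero_iff_mem]
    simpa [I] using (Ideal.mem_of_liesOver P I (p : ℤ)).1 (Ideal.mem_span_singleton_self _)
  let := ZMod.algebra (𝓞 K ⧸ P) p
  have hsO : (f.map (algebraMap ℤ (𝓞 K))).Splits := by
    refine Splits.of_splits_map_of_injective (i := algebraMap (𝓞 K) K)
      (FaithfulSMul.algebraMap_injective _ _) ?_ ?_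
    · rwa [Polynomial.map_map, ← IsScalarTower.algebraMap_eq]
    · intro x hx
      refine ⟨⟨x, f, hf, ?_⟩, rfl⟩
      rw [Polynomial.map_map, ← IsScalarTower.algebraMap_eq] at hx
      rw [← eval_map]
      exact (mem_roots'.1 hx).2
  have hsP : (f.map (algebraMap ℤ (𝓞 K ⧸ P))).Splits := by
    have := hsO.map (Ideal.Quotient.mk P)
    rw [Polynomial.map_map] at this
    convert this using 2
    exact RingHom.ext_int _ _
  have hsh : (h.map (algebraMap (ZMod p) (𝓞 K ⧸ P))).Splits := by
    refine hsP.of_dvd (hf.map _).ne_zero ?_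
    have := Polynomial.map_dvd (algebraMap (ZMod p) (𝓞 K ⧸ P)) hdvd
    rw [Polynomial.map_map] at this
    convert this using 2
    exact RingHom.ext_int _ _
  have hfr : Module.finrank (ZMod p) (𝓞 K ⧸ P) = P.inertiaDeg ℤ := by
    apply Nat.pow_right_injective hp.two_le
    have h₁ := Module.natCard_eq_pow_finrank (K := ZMod p) (V := 𝓞 K ⧸ P)
    rw [Nat.card_zmod] at h₁
    simp only [Ideal.pow_inertiaDeg p P, Ideal.absNorm_apply, Submodule.cardQuot_apply]
    exact h₁.symm
  have hG := Ideal.ncard_primesOver_mul_ramificationIdxIn_mul_inertiaDegIn I (𝓞 K) Gal(K/ℚ)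
  rw [Ideal.inertiaDegIn_eq_inertiaDeg I P Gal(K/ℚ),
    IsGaloisGroup.card_eq_finrank Gal(K/ℚ) ℚ K] at hG
  exact (hh.natDegree_dvd_finrank hsh).trans
    (hfr ▸ hG ▸ Dvd.dvd.mul_left (Dvd.intro_left _ rfl) _)

/-- If `ℚ(α)` is normal, where `α` is a root of the monic irreducible `f : ℤ[X]`, the degree of any
irreducible factor of `f` modulo `p` divides the degree of `f`. -/
lemma natDegree_dvd_natDegree_of_normal {f : ℤ[X]} (hf : f.Monic) (hfi : Irreducible f)
    {L : Type*} [Field L] [CharZero L] {α : L} (hα : aeval α f = 0)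
    (hnormal : Normal ℚ (adjoin ℚ ({α} : Set L))) {p : ℕ} [Fact p.Prime]
    {h : (ZMod p)[X]} (hh : Irreducible h) (hdvd : h ∣ f.map (algebraMap ℤ (ZMod p))) :
    h.natDegree ∣ f.natDegree := by
  have hint : IsIntegral ℚ α := IsIntegral.tower_top (R := ℤ) ⟨f, hf, by simpa [aeval_def] using hα⟩
  have : FiniteDimensional ℚ ℚ⟮α⟯ := adjoin.finiteDimensional hint
  have : NumberField ℚ⟮α⟯ := ⟨⟩
  have : IsGalois ℚ ℚ⟮α⟯ := ⟨⟩
  have hmin : minpoly ℚ α = f.map (algebraMap ℤ ℚ) := by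
    refine (minpoly.eq_of_irreducible_of_monic
      ((hf.irreducible_iff_irreducible_map_fraction_map (K := ℚ)).1 hfi) ?_ (hf.map _)).symm
    rwa [aeval_map_algebraMap]
  have hfin : Module.finrank ℚ ℚ⟮α⟯ = f.natDegree := by
    rw [adjoin.finrank hint, hmin, hf.natDegree_map]
  rw [← hfin]
  refine natDegree_dvd_finrank_of_dvd_map_zmod hf ?_ hh hdvd
  have := hnormal.splits (AdjoinSimple.gen ℚ α)
  have hgen : minpoly ℚ (AdjoinSimple.gen ℚ α) = minpoly ℚ α := minpoly_gen ℚ α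
  rwa [hgen, hmin, Polynomial.map_map, ← IsScalarTower.algebraMap_eq] at this

/-- let `f, g ∈ ℤ[x]` be monic irreducible polynomials of coprime degrees
such that `ℚ[x]/(f)` and `ℚ[x]/(g)` are normal extensions of `ℚ` (here realized as `ℚ(α)`
and `ℚ(β)` for roots `α`, `β` in a fixed algebraic closure of `ℚ`). Then for every prime
`p` and every root `t ∈ 𝔽_p` of `R_{f,g} mod p`, there exist `r, s ∈ 𝔽_p` with
`f(r) ≡ 0 (mod p)`, `g(s) ≡ 0 (mod p)` and `t = r + s`. -/
theorem stmt10 (f g : ℤ[X]) (hf : f.Monic) (hg : g.Monic)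
    (hfi : Irreducible f) (hgi : Irreducible g)
    (hcop : Nat.Coprime f.natDegree g.natDegree)
    (α β : AlgebraicClosure ℚ)
    (hα : Polynomial.aeval α f = 0) (hβ : Polynomial.aeval β g = 0)
    (hfnormal : Normal ℚ (adjoin ℚ ({α} : Set (AlgebraicClosure ℚ))))
    (hgnormal : Normal ℚ (adjoin ℚ ({β} : Set (AlgebraicClosure ℚ))))
    (p : ℕ) (hp : p.Prime) (t : ZMod p)
    (ht : Polynomial.aeval t (Rres f g) = 0) :
    ∃ r s : ZMod p, Polynomial.aeval r f = 0 ∧ Polynomial.aeval s g = 0 ∧ t = r + s := by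
  have : Fact p.Prime := ⟨hp⟩
  obtain ⟨h, hh, hhf, hhg⟩ := exists_irreducible_dvd_of_aeval_Rres_eq_zero hf hg ht
  have hdf := natDegree_dvd_natDegree_of_normal hf hfi hα hfnormal hh hhf
  have hdg := natDegree_dvd_natDegree_of_normal hg hgi hβ hgnormal (hh.comp_C_sub_X t) (by
    have := map_dvd (compRingHom (C t - X)) hhg
    rwa [coe_compRingHom_apply, coe_compRingHom_apply, comp_C_sub_X_comp_C_sub_X] at this)
  rw [natDegree_comp_C_sub_X] at hdg
  have hd : h.natDegree = 1 := Nat.eq_one_of_dvd_coprimes hcop hdf hdg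
  obtain ⟨r, hr⟩ := exists_root_of_degree_eq_one ((degree_eq_iff_natDegree_eq hh.ne_zero).2 hd)
  refine ⟨r, t - r, ?_, ?_, by ring⟩
  · rw [← eval_map_algebraMap]
    exact hr.dvd hhf
  · rw [← eval_map_algebraMap]
    simpa [eval_comp] using (hr.dvd hhg).eq_zero
end
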